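/- Let h : [-1,1] × [-1,0] → ℝ be a solution of the heat equation on the rectangle [-1,1] × [-1,0]. Then for every x ∈ (-1,1) the Green's representation formula holds: h(x,0) = ∫_{-1}^{1} K_1(x,y) h(y,-1) dy − ∫_0^1 h(1,-t) · ∂_y K_t(x,y)|_{y=1} dt + ∫_0^1 h(-1,-t) · ∂_y K_t(x,y)|_{y=-1} dt. -/

import Mathlib

open Real Set

/-- The Dirichlet heat kernel of the interval `[-1,1]`:
`K t x y = (4πt)^{-1/2} (∑_{k ∈ ℤ} e^{-(x-y+4k)²/(4t)} − ∑_{k ∈ ℤ} e^{-(x+y+4k-2)²/(4t)})`. -/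
noncomputable def K (t x y : ℝ) : ℝ :=
  (Real.sqrt (4 * Real.pi * t))⁻¹ *
    ((∑' k : ℤ, Real.exp (-(x - y + 4 * (k : ℝ)) ^ 2 / (4 * t))) -
     (∑' k : ℤ, Real.exp (-(x + y + 4 * (k : ℝ) - 2) ^ 2 / (4 * t))))

/-- `h : ℝ → ℝ → ℝ` (first argument space, second argument time) is a solution of the
heat equation on the rectangle `[-1,1] × [-1,0]`: it is continuous on the closed rectangle,
smooth on `(-1,1) × (-1,0]`, and satisfies `∂_t h = ∂²_x h` there (the time derivative at
`t = 0` being the one-sided derivative within `(-∞,0]`). -/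
def IsHeatSolution (h : ℝ → ℝ → ℝ) : Prop :=
  ContinuousOn (fun p : ℝ × ℝ => h p.1 p.2) (Set.Icc (-1) 1 ×ˢ Set.Icc (-1) 0) ∧
  ContDiffOn ℝ (⊤ : ℕ∞) (fun p : ℝ × ℝ => h p.1 p.2) (Set.Ioo (-1) 1 ×ˢ Set.Ioc (-1) 0) ∧
  ∀ x ∈ Set.Ioo (-1 : ℝ) 1, ∀ t ∈ Set.Ioc (-1 : ℝ) 0,
    derivWithin (fun s => h x s) (Set.Iic 0) t = deriv (deriv (fun y => h y t)) x

open MeasureTheory Filter Topology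

/-- Gaussian heat kernel. -/
noncomputable def G (t z : ℝ) : ℝ := (Real.sqrt (4 * Real.pi * t))⁻¹ * Real.exp (-z ^ 2 / (4 * t))

/-- Space derivative of the Gaussian heat kernel. -/
noncomputable def Gz (t z : ℝ) : ℝ := -(z / (2 * t)) * G t z

lemma G_fderiv (c : ℝ) (q : ℝ × ℝ) (hq : 0 < q.2) :
    HasFDerivAt (fun q : ℝ × ℝ => G q.2 (c - q.1))
      ((-(Gz q.2 (c - q.1))) • ContinuousLinearMap.fst ℝ ℝ ℝ +
        (((c - q.1) ^ 2 / (4 * q.2 ^ 2) - 1 / (2 * q.2)) * G q.2 (c - q.1)) •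
          ContinuousLinearMap.snd ℝ ℝ ℝ) q := by
  have h2 : HasFDerivAt (fun q : ℝ × ℝ => q.2) (ContinuousLinearMap.snd ℝ ℝ ℝ) q := hasFDerivAt_snd
  have h1 : HasFDerivAt (fun q : ℝ × ℝ => q.1) (ContinuousLinearMap.fst ℝ ℝ ℝ) q := hasFDerivAt_fst
  have hpos : 0 < 4 * Real.pi * q.2 := by positivity
  have hs : 0 < Real.sqrt (4 * Real.pi * q.2) := Real.sqrt_pos.2 hpos
  have hss : Real.sqrt (4 * Real.pi * q.2) ^ 2 = 4 * Real.pi * q.2 := Real.sq_sqrt hpos.le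
  have hpre : HasDerivAt (fun t : ℝ => (Real.sqrt (4 * Real.pi * t))⁻¹)
      (-(1 / (2 * q.2)) * (Real.sqrt (4 * Real.pi * q.2))⁻¹) q.2 := by
    have := (((hasDerivAt_id q.2).const_mul (4 * Real.pi)).sqrt hpos.ne').inv hs.ne'
    refine this.congr_deriv ?_
    simp only [id]
    rw [hss]
    field_simp
  have hz : HasDerivAt (fun y : ℝ => -(c - y) ^ 2) (2 * (c - q.1)) q.1 := by
    have := (((hasDerivAt_id q.1).const_sub c).pow 2).neg
    refine this.congr_deriv ?_
    simp; 
  have ht : HasDerivAt (fun t : ℝ => (4 * t)⁻¹) (-(1 / (4 * q.2 ^ 2))) q.2 := by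
    have := ((hasDerivAt_id q.2).const_mul 4).inv (by simp; exact hq.ne')
    refine this.congr_deriv ?_
    simp only [id]; field_simp
  have := (hpre.comp_hasFDerivAt q h2).mul
    ((hz.comp_hasFDerivAt q h1).mul (ht.comp_hasFDerivAt q h2)).exp
  refine (this.congr_of_eventuallyEq ?_).congr_fderiv ?_
  · exact Eventually.of_forall fun p => by simp [G, div_eq_mul_inv]
  · ext
    · simp [G, Gz, div_eq_mul_inv]; ring
    · simp [G, Gz, div_eq_mul_inv]; ring

lemma Gz_fderiv (c : ℝ) (q : ℝ × ℝ) (hq : 0 < q.2) :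
    ∃ A : ℝ × ℝ →L[ℝ] ℝ, HasFDerivAt (fun q : ℝ × ℝ => Gz q.2 (c - q.1)) A q ∧
      A (1, 0) = -(((c - q.1) ^ 2 / (4 * q.2 ^ 2) - 1 / (2 * q.2)) * G q.2 (c - q.1)) := by
  have h2 : HasFDerivAt (fun q : ℝ × ℝ => q.2) (ContinuousLinearMap.snd ℝ ℝ ℝ) q := hasFDerivAt_snd
  have h1 : HasFDerivAt (fun q : ℝ × ℝ => q.1) (ContinuousLinearMap.fst ℝ ℝ ℝ) q := hasFDerivAt_fst
  have ht : HasDerivAt (fun t : ℝ => (2 * t)⁻¹) (-(1 / (2 * q.2 ^ 2))) q.2 := by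
    have := ((hasDerivAt_id q.2).const_mul 2).inv (by simp; exact hq.ne')
    refine this.congr_deriv ?_
    simp only [id]; field_simp
  have := ((h1.const_sub c).mul (ht.comp_hasFDerivAt q h2)).neg.mul (G_fderiv c q hq)
  refine ⟨_, this.congr_of_eventuallyEq ?_, ?_⟩
  · exact Eventually.of_forall fun p => by simp [Gz, div_eq_mul_inv]
  · simp [Gz]; field_simp; ring

/-- abstract backward heat solution, smooth up to the boundary. -/
structure Sol (v p : ℝ × ℝ → ℝ) (v' p' : ℝ × ℝ → ℝ × ℝ →L[ℝ] ℝ) : Prop where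
  hv : ∀ q ∈ Icc (-1 : ℝ) 1 ×ˢ Icc (0 : ℝ) 1, HasFDerivAt v (v' q) q
  hp : ∀ q ∈ Icc (-1 : ℝ) 1 ×ˢ Icc (0 : ℝ) 1, HasFDerivAt p (p' q) q
  hvp : ∀ q ∈ Icc (-1 : ℝ) 1 ×ˢ Icc (0 : ℝ) 1, v' q (1, 0) = p q
  heq : ∀ q ∈ Icc (-1 : ℝ) 1 ×ˢ Icc (0 : ℝ) 1, p' q (1, 0) = - v' q (0, 1)

lemma green_eps {v p v' p'} (S : Sol v p v' p') (c ε : ℝ) (h0 : 0 < ε) (h1 : ε ≤ 1) :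
    (∫ y in (-1 : ℝ)..1, G 1 (c - y) * v (y, 1)) - (∫ y in (-1 : ℝ)..1, G ε (c - y) * v (y, ε))
    = (∫ t in ε..1, (-Gz t (c - 1) * v (1, t) - G t (c - 1) * p (1, t)))
     - (∫ t in ε..1, (-Gz t (c - (-1)) * v (-1, t) - G t (c - (-1)) * p (-1, t))) := by
  have hsub : Icc (-1 : ℝ) 1 ×ˢ Icc ε 1 ⊆ Icc (-1 : ℝ) 1 ×ˢ Icc (0 : ℝ) 1 :=
    prod_mono le_rfl (Icc_subset_Icc h0.le le_rfl)
  have key : ∀ q ∈ Icc (-1 : ℝ) 1 ×ˢ Icc ε 1, ∃ A B : ℝ × ℝ →L[ℝ] ℝ,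
      HasFDerivAt (fun q : ℝ × ℝ => -Gz q.2 (c - q.1) * v q - G q.2 (c - q.1) * p q) A q ∧
      HasFDerivAt (fun q : ℝ × ℝ => -(G q.2 (c - q.1) * v q)) B q ∧
      A (1, 0) + B (0, 1) = 0 := by
    intro q hq
    have hq2 : 0 < q.2 := lt_of_lt_of_le h0 hq.2.1
    obtain ⟨A, hA, hA1⟩ := Gz_fderiv c q hq2
    have hG := G_fderiv c q hq2
    refine ⟨_, _, (hA.neg.mul (S.hv q (hsub hq))).sub (hG.mul (S.hp q (hsub hq))),
      (hG.mul (S.hv q (hsub hq))).neg, ?_⟩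
    simp [hA1, S.hvp q (hsub hq), S.heq q (hsub hq)]
    ring
  choose! A B hA hB hAB using key
  have hu1 : uIcc (-1 : ℝ) 1 = Icc (-1) 1 := uIcc_of_le (by norm_num)
  have hu2 : uIcc ε 1 = Icc ε 1 := uIcc_of_le h1
  have hmem : ∀ q, q ∈ Ioo (min (-1 : ℝ) 1) (max (-1) 1) ×ˢ Ioo (min ε 1) (max ε 1) →
      q ∈ Icc (-1 : ℝ) 1 ×ˢ Icc ε 1 := by
    intro q hq
    rw [min_eq_left h1, max_eq_right h1, min_eq_left (by norm_num), max_eq_right (by norm_num)] at hq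
    exact ⟨Ioo_subset_Icc_self hq.1, Ioo_subset_Icc_self hq.2⟩
  have := integral2_divergence_prod_of_hasFDerivAt
    (fun q : ℝ × ℝ => -Gz q.2 (c - q.1) * v q - G q.2 (c - q.1) * p q)
    (fun q : ℝ × ℝ => -(G q.2 (c - q.1) * v q)) A B (-1) ε 1 1
    (by rw [hu1, hu2]; exact fun q hq => (hA q hq).continuousAt.continuousWithinAt)
    (by rw [hu1, hu2]; exact fun q hq => (hB q hq).continuousAt.continuousWithinAt)
    (fun q hq => hA q (hmem q hq)) (fun q hq => hB q (hmem q hq))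
    (by
      rw [hu1, hu2]
      refine (integrableOn_zero).congr_fun (fun q hq => (hAB q hq).symm) ?_
      exact measurableSet_Icc.prod measurableSet_Icc)
  have hz : (∫ x in (-1 : ℝ)..1, ∫ y in ε..1, A (x, y) (1, 0) + B (x, y) (0, 1)) = 0 := by
    rw [intervalIntegral.integral_congr (g := fun _ => 0)]
    · simp
    · intro x hx
      rw [hu1] at hx
      show (∫ y in ε..1, A (x, y) (1, 0) + B (x, y) (0, 1)) = 0
      rw [intervalIntegral.integral_congr (g := fun _ => 0)]
      · simp
      · intro y hy
        rw [hu2] at hy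
        exact hAB (x, y) ⟨hx, hy⟩
  rw [hz] at this
  simp only [intervalIntegral.integral_neg] at this
  linarith

lemma summable_inv_sq (b : ℝ) : Summable (fun k : ℤ => 1 / (b + 4 * (k : ℝ)) ^ 2) := by
  have := ((Real.summable_one_div_int_add_rpow (b / 4) 2).2 (by norm_num)).mul_left (1 / 16)
  refine this.congr fun k => ?_
  have e : b + 4 * (k : ℝ) = 4 * (k + b / 4) := by ring
  rw [e, mul_pow]
  norm_num
  ring

lemma summable_inv_cube (b : ℝ) : Summable (fun k : ℤ => 1 / |b + 4 * (k : ℝ)| ^ 3) := by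
  have := ((Real.summable_one_div_int_add_rpow (b / 4) 3).2 (by norm_num)).mul_left (1 / 64)
  refine this.congr fun k => ?_
  have e : b + 4 * (k : ℝ) = 4 * (k + b / 4) := by ring
  rw [e, abs_mul, mul_pow]
  norm_num
  ring

lemma exp_neg_le (b : ℝ) (hb : 0 ≤ b) : Real.exp (-b) * (1 + b + b ^ 2 / 2) ≤ 1 := by
  have h1 := Real.quadratic_le_exp_of_nonneg hb
  calc _ ≤ Real.exp (-b) * Real.exp b := by gcongr
    _ = 1 := by rw [← Real.exp_add]; simp

lemma pre_bound (t : ℝ) (h0 : 0 < t) (h1 : t ≤ 1) : (Real.sqrt (4 * Real.pi * t))⁻¹ * t ≤ 1 := by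
  have : t ≤ Real.sqrt (4 * Real.pi * t) := by
    apply Real.le_sqrt_of_sq_le
    nlinarith [Real.pi_gt_three]
  have h : 0 < Real.sqrt (4 * Real.pi * t) := lt_of_lt_of_le h0 this
  rw [inv_mul_le_iff₀ h]; linarith

lemma G_nonneg (t z : ℝ) : 0 ≤ G t z := by unfold G; positivity

lemma G_even (t z : ℝ) : G t (-z) = G t z := by simp [G]

lemma Gz_odd (t z : ℝ) : Gz t (-z) = -Gz t z := by simp [Gz, G_even]; ring

lemma G_bound (t z : ℝ) (h0 : 0 < t) (h1 : t ≤ 1) (hz : z ≠ 0) : |G t z| ≤ 4 / z ^ 2 := by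
  rw [abs_of_nonneg (G_nonneg t z)]
  have hz2 : 0 < z ^ 2 := by positivity
  have hp := pre_bound t h0 h1
  have he := exp_neg_le (z ^ 2 / (4 * t)) (by positivity)
  rw [le_div_iff₀ hz2]
  unfold G
  set P := (Real.sqrt (4 * Real.pi * t))⁻¹ with hP
  have hP0 : 0 ≤ P := by positivity
  rw [neg_div]
  set b := z ^ 2 / (4 * t) with hb
  have hb0 : 0 ≤ b := by positivity
  have hzb : z ^ 2 = 4 * t * b := by rw [hb]; field_simp
  have hE : 0 < Real.exp (-b) := Real.exp_pos _
  have h3 : Real.exp (-b) * b ≤ 1 := by nlinarith [mul_nonneg hE.le (sq_nonneg b)]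
  rw [hzb]
  calc P * Real.exp (-b) * (4 * t * b) = 4 * (P * t) * (Real.exp (-b) * b) := by ring
    _ ≤ 4 * 1 * 1 := by gcongr
    _ = 4 := by norm_num

lemma Gz_bound (t z : ℝ) (h0 : 0 < t) (h1 : t ≤ 1) (hz : z ≠ 0) : |Gz t z| ≤ 16 / |z| ^ 3 := by
  have hz2 : 0 < |z| := abs_pos.2 hz
  have hp := pre_bound t h0 h1
  have he := exp_neg_le (z ^ 2 / (4 * t)) (by positivity)
  rw [le_div_iff₀ (by positivity), Gz, abs_mul, abs_neg, abs_div, abs_of_nonneg (G_nonneg t z),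
    abs_of_pos (show 0 < 2 * t by positivity)]
  unfold G
  set P := (Real.sqrt (4 * Real.pi * t))⁻¹ with hP
  have hP0 : 0 ≤ P := by positivity
  rw [neg_div]
  set b := z ^ 2 / (4 * t) with hb
  have hb0 : 0 ≤ b := by positivity
  have hzb : |z| ^ 2 = 4 * t * b := by rw [hb, sq_abs]; field_simp
  have hE : 0 < Real.exp (-b) := Real.exp_pos _
  have h3 : Real.exp (-b) * b ^ 2 ≤ 2 := by nlinarith [mul_nonneg hE.le hb0]
  calc |z| / (2 * t) * (P * Real.exp (-b)) * |z| ^ 3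
      = (|z| ^ 2) ^ 2 / (2 * t) * P * Real.exp (-b) := by ring
    _ = 8 * (P * t) * (Real.exp (-b) * b ^ 2) := by rw [hzb]; field_simp; ring
    _ ≤ 8 * 1 * 2 := by gcongr
    _ = 16 := by norm_num

lemma G_one_bound (c y : ℝ) (hy : y ∈ Icc (-1 : ℝ) 1) (hc : c + 1 ≠ 0) :
    |G 1 (c - y)| ≤ 16 / (c + 1) ^ 2 := by
  have hc2 : 0 < (c + 1) ^ 2 := by positivity
  have hp := pre_bound 1 one_pos le_rfl
  have he := exp_neg_le ((c - y) ^ 2 / (4 * 1)) (by positivity)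
  rw [le_div_iff₀ hc2, abs_of_nonneg (G_nonneg _ _)]
  unfold G
  set P := (Real.sqrt (4 * Real.pi * 1))⁻¹ with hP
  have hP0 : 0 ≤ P := by positivity
  rw [neg_div]
  set b := (c - y) ^ 2 / (4 * 1) with hb
  have hb0 : 0 ≤ b := by positivity
  have hzb : (c - y) ^ 2 = 4 * b := by rw [hb]; field_simp
  have hE : 0 < Real.exp (-b) := Real.exp_pos _
  have h3 : Real.exp (-b) * (1 + b) ≤ 1 := by nlinarith [mul_nonneg hE.le (sq_nonneg b)]
  have h4 : (c + 1) ^ 2 ≤ 8 * (1 + b) := by nlinarith [hy.1, hy.2, sq_nonneg (c - 2 * y - 1)]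
  have h5 : P ≤ 1 := by simpa using hp
  calc P * Real.exp (-b) * (c + 1) ^ 2 ≤ 1 * Real.exp (-b) * (8 * (1 + b)) := by gcongr
    _ = 8 * (Real.exp (-b) * (1 + b)) := by ring
    _ ≤ 16 := by linarith

lemma theta_summable (t a : ℝ) (ht : 0 < t) :
    Summable (fun k : ℤ => Real.exp (-(a + 4 * (k : ℝ)) ^ 2 / (4 * t))) := by
  refine Summable.of_norm_bounded_eventually (g := fun k : ℤ => (4 * t) * (1 / (a + 4 * (k : ℝ)) ^ 2))
    ((summable_inv_sq a).mul_left _) ?_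
  have hfin : {k : ℤ | a + 4 * (k : ℝ) = 0}.Finite := by
    apply Set.Subsingleton.finite
    intro k hk l hl
    simp only [Set.mem_ofPred_eq] at hk hl
    have : (k : ℝ) = l := by linarith
    exact_mod_cast this
  filter_upwards [hfin.compl_mem_cofinite] with k hk
  have hk' : a + 4 * (k : ℝ) ≠ 0 := hk
  set z := a + 4 * (k : ℝ)
  have he := exp_neg_le (z ^ 2 / (4 * t)) (by positivity)
  rw [Real.norm_eq_abs, abs_of_pos (Real.exp_pos _), mul_one_div, le_div_iff₀ (by positivity), neg_div]
  set b := z ^ 2 / (4 * t) with hb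
  have hb0 : 0 ≤ b := by positivity
  have hzb : z ^ 2 = 4 * t * b := by rw [hb]; field_simp
  have hE : 0 < Real.exp (-b) := Real.exp_pos _
  have h3 : Real.exp (-b) * b ≤ 1 := by nlinarith [mul_nonneg hE.le (sq_nonneg b)]
  rw [hzb]
  calc _ = 4 * t * (Real.exp (-b) * b) := by ring
    _ ≤ 4 * t * 1 := by gcongr
    _ = _ := by ring

lemma theta_deriv (t a : ℝ) (ht : 0 < t) (ha : ∀ k : ℤ, a + 4 * (k : ℝ) ≠ 0) :
    HasDerivAt (fun a : ℝ => ∑' k : ℤ, Real.exp (-(a + 4 * (k : ℝ)) ^ 2 / (4 * t)))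
      (∑' k : ℤ, -((a + 4 * (k : ℝ)) / (2 * t)) * Real.exp (-(a + 4 * (k : ℝ)) ^ 2 / (4 * t))) a := by
  have hball : a ∈ Ioo (a - 1) (a + 1) := ⟨by linarith, by linarith⟩
  refine hasDerivAt_tsum_of_isPreconnected (t := Ioo (a - 1) (a + 1)) (y₀ := a)
    (u := fun k : ℤ => ((1 / (2 * t)) * (2 + 64 * t ^ 2) * 2) * (1 / (a + 4 * (k : ℝ)) ^ 2))
    (g := fun (k : ℤ) (a : ℝ) => Real.exp (-(a + 4 * (k : ℝ)) ^ 2 / (4 * t)))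
    (g' := fun (k : ℤ) (a : ℝ) => -((a + 4 * (k : ℝ)) / (2 * t)) * Real.exp (-(a + 4 * (k : ℝ)) ^ 2 / (4 * t)))
    ((summable_inv_sq a).mul_left _) isOpen_Ioo isPreconnected_Ioo ?_ ?_ hball
    (theta_summable t a ht) hball
  · intro k y _
    have := (((((hasDerivAt_id y).add_const (4 * (k : ℝ))).pow 2).neg).div_const (4 * t)).exp
    refine this.congr_deriv ?_
    simp
    field_simp
    ring
  · intro k y hy
    have hk := ha k
    have hz0 : 0 < (a + 4 * (k : ℝ)) ^ 2 := by positivity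
    have h1 : (a + 4 * (k : ℝ)) ^ 2 ≤ 2 * (1 + (y + 4 * (k : ℝ)) ^ 2) := by
      nlinarith [sq_nonneg (a + 4 * (k : ℝ) - 2 * (y + 4 * (k : ℝ))), hy.1, hy.2]
    set z := y + 4 * (k : ℝ)
    set w := a + 4 * (k : ℝ)
    have he := exp_neg_le (z ^ 2 / (4 * t)) (by positivity)
    rw [Real.norm_eq_abs, abs_mul, abs_neg, abs_div, abs_of_pos (Real.exp_pos _),
      abs_of_pos (show 0 < 2 * t by positivity), mul_one_div, le_div_iff₀ hz0, neg_div]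
    set b := z ^ 2 / (4 * t) with hb
    have hb0 : 0 ≤ b := by positivity
    have hzb : z ^ 2 = 4 * t * b := by rw [hb]; field_simp
    have hE : 0 < Real.exp (-b) := Real.exp_pos _
    have hE1 : Real.exp (-b) ≤ 1 := by simpa using hb0
    have h3 : Real.exp (-b) * b ^ 2 ≤ 2 := by nlinarith [mul_nonneg hE.le hb0]
    have h4 : |z| * (1 + z ^ 2) ≤ 2 * (1 + (z ^ 2) ^ 2) := by
      rw [← sq_abs z]; nlinarith [sq_nonneg (|z| - 1), sq_nonneg (|z| ^ 2 - |z|), abs_nonneg z, sq_nonneg (|z|^2 - 1)]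
    calc |z| / (2 * t) * Real.exp (-b) * w ^ 2
        ≤ |z| / (2 * t) * Real.exp (-b) * (2 * (1 + z ^ 2)) := by gcongr
      _ = (1 / (2 * t)) * (Real.exp (-b) * (|z| * (1 + z ^ 2))) * 2 := by ring
      _ ≤ (1 / (2 * t)) * (Real.exp (-b) * (2 * (1 + (z ^ 2) ^ 2))) * 2 := by gcongr
      _ = (1 / (2 * t)) * (2 * Real.exp (-b) + 32 * t ^ 2 * (Real.exp (-b) * b ^ 2)) * 2 := by
          rw [hzb]; ring
      _ ≤ (1 / (2 * t)) * (2 * 1 + 32 * t ^ 2 * 2) * 2 := by gcongr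
      _ = _ := by ring

lemma delta_limit (v : ℝ × ℝ → ℝ) (hv : ContinuousOn v (Icc (-1 : ℝ) 1 ×ˢ Icc (0 : ℝ) 1)) (c : ℝ)
    (hc : |c| ≠ 1) :
    Tendsto (fun ε => ∫ y in (-1 : ℝ)..1, G ε (c - y) * v (y, ε)) (𝓝[>] 0)
      (𝓝 (if |c| < 1 then v (c, 0) else 0)) := by
  classical
  set δ := (if |c| < 1 then v (c, 0) else 0) with hδ
  obtain ⟨C, hC⟩ := (isCompact_Icc.prod isCompact_Icc).exists_bound_of_continuousOn hv
  have hC0 : 0 ≤ C := (norm_nonneg _).trans (hC (0, 0) (by constructor <;> constructor <;> norm_num))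
  set W : ℝ → ℝ → ℝ := fun ε => (Ioc (-1 : ℝ) 1).indicator (fun y => v (y, ε)) with hW
  have hev : ∀ᶠ ε in 𝓝[>] (0 : ℝ), ε ∈ Ioc (0 : ℝ) 1 := Ioc_mem_nhdsGT one_pos
  have hWb : ∀ ε ∈ Ioc (0 : ℝ) 1, ∀ y, |W ε y| ≤ C := by
    intro ε hε y
    simp only [hW, indicator]
    split_ifs with h
    · exact hC (y, ε) ⟨Ioc_subset_Icc_self h, Ioc_subset_Icc_self hε⟩
    · simpa using hC0
  have hWm : ∀ ε ∈ Ioc (0 : ℝ) 1, Measurable (W ε) := by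
    intro ε hε
    have hcont : ContinuousOn (fun y => v (y, ε)) (Ioc (-1 : ℝ) 1) := by
      refine hv.comp (by fun_prop) ?_
      intro y hy
      exact ⟨Ioc_subset_Icc_self hy, Ioc_subset_Icc_self hε⟩
    have := hcont.measurable_piecewise (g := fun _ => (0 : ℝ)) continuousOn_const measurableSet_Ioc
    rwa [show (fun _ : ℝ => (0 : ℝ)) = 0 from rfl, piecewise_eq_indicator] at this
  have hrew : ∀ ε ∈ Ioc (0 : ℝ) 1, (∫ y in (-1 : ℝ)..1, G ε (c - y) * v (y, ε)) =
      ∫ u : ℝ, (Real.sqrt Real.pi)⁻¹ * Real.exp (-1 * u ^ 2) * W ε (c + 2 * Real.sqrt ε * u) := by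
    intro ε hε
    have hs : 0 < Real.sqrt ε := Real.sqrt_pos.2 hε.1
    have hss : Real.sqrt ε ^ 2 = ε := Real.sq_sqrt hε.1.le
    rw [intervalIntegral.integral_of_le (by norm_num), ← integral_indicator measurableSet_Ioc]
    have e1 : (Ioc (-1 : ℝ) 1).indicator (fun y => G ε (c - y) * v (y, ε)) =
        fun y => G ε (c - y) * W ε y := by
      ext y; simp [hW, indicator]
    rw [e1, ← integral_add_left_eq_self _ c]
    have e2 := Measure.integral_comp_mul_left (fun y => G ε (c - (c + y)) * W ε (c + y))
      (2 * Real.sqrt ε)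
    have e3 : (∫ y, G ε (c - (c + y)) * W ε (c + y)) = 2 * Real.sqrt ε *
        ∫ x, G ε (c - (c + 2 * Real.sqrt ε * x)) * W ε (c + 2 * Real.sqrt ε * x) := by
      rw [e2, abs_of_pos (by positivity), smul_eq_mul, ← mul_assoc, mul_inv_cancel₀ (by positivity),
        one_mul]
    rw [e3, ← integral_const_mul]
    congr 1
    ext u
    rw [← mul_assoc]
    congr 1
    rw [G, show 4 * Real.pi * ε = (2 ^ 2 * Real.pi) * ε by ring, Real.sqrt_mul (by positivity),
      Real.sqrt_mul (by positivity), Real.sqrt_sq (by norm_num)]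
    have : -(c - (c + 2 * Real.sqrt ε * u)) ^ 2 / (4 * ε) = -1 * u ^ 2 := by
      have : (c - (c + 2 * Real.sqrt ε * u)) ^ 2 = 4 * ε * u ^ 2 := by
        calc _ = 4 * Real.sqrt ε ^ 2 * u ^ 2 := by ring
          _ = _ := by rw [hss]
      rw [this]
      have := hε.1
      field_simp
    rw [this]
    have := Real.sqrt_pos.2 Real.pi_pos
    field_simp
  have hlim : Tendsto (fun ε => ∫ u : ℝ, (Real.sqrt Real.pi)⁻¹ * Real.exp (-1 * u ^ 2) *
      W ε (c + 2 * Real.sqrt ε * u)) (𝓝[>] 0)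
      (𝓝 (∫ u : ℝ, (Real.sqrt Real.pi)⁻¹ * Real.exp (-1 * u ^ 2) * δ)) := by
    refine tendsto_integral_filter_of_dominated_convergence
      (fun u => (Real.sqrt Real.pi)⁻¹ * Real.exp (-1 * u ^ 2) * C) ?_ ?_ ?_ ?_
    · filter_upwards [hev] with ε hε
      have := hWm ε hε
      exact Measurable.aestronglyMeasurable (by fun_prop)
    · filter_upwards [hev] with ε hε
      refine Eventually.of_forall fun u => ?_
      rw [norm_mul, Real.norm_of_nonneg (show 0 ≤ (Real.sqrt Real.pi)⁻¹ * Real.exp (-1 * u ^ 2) by positivity)]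
      have := hWb ε hε (c + 2 * Real.sqrt ε * u)
      rw [Real.norm_eq_abs]
      gcongr
    · exact ((integrable_exp_neg_mul_sq one_pos).const_mul _).mul_const _
    · refine Eventually.of_forall fun u => ?_
      refine Tendsto.const_mul _ ?_
      have hto : Tendsto (fun ε : ℝ => c + 2 * Real.sqrt ε * u) (𝓝[>] 0) (𝓝 c) := by
        have : Continuous (fun ε : ℝ => c + 2 * Real.sqrt ε * u) := by fun_prop
        have := (this.tendsto 0).mono_left (nhdsWithin_le_nhds (s := Ioi 0))
        simpa using this
      by_cases h : |c| < 1
      · rw [hδ, if_pos h]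
        have hin : ∀ᶠ ε in 𝓝[>] (0 : ℝ), c + 2 * Real.sqrt ε * u ∈ Ioo (-1 : ℝ) 1 :=
          hto (Ioo_mem_nhds (abs_lt.1 h).1 (abs_lt.1 h).2)
        have hcw := hv (c, 0) ⟨⟨(abs_lt.1 h).1.le, (abs_lt.1 h).2.le⟩, by norm_num⟩
        have ht2 : Tendsto (fun ε : ℝ => (c + 2 * Real.sqrt ε * u, ε)) (𝓝[>] 0)
            (𝓝[Icc (-1 : ℝ) 1 ×ˢ Icc (0 : ℝ) 1] (c, 0)) := by
          refine tendsto_nhdsWithin_iff.2 ⟨?_, ?_⟩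
          · exact hto.prodMk_nhds (tendsto_id.mono_left nhdsWithin_le_nhds)
          · filter_upwards [hin, hev] with ε h1 h2
            exact ⟨Ioo_subset_Icc_self h1, Ioc_subset_Icc_self h2⟩
        refine (hcw.tendsto.comp ht2).congr' ?_
        filter_upwards [hin] with ε h1
        simp only [hW, Function.comp]
        rw [indicator_of_mem (Ioo_subset_Ioc_self h1)]
      · rw [hδ, if_neg h]
        have h' : 1 < |c| := lt_of_le_of_ne (not_lt.1 h) (Ne.symm hc)
        have hin : ∀ᶠ ε in 𝓝[>] (0 : ℝ), 1 < |c + 2 * Real.sqrt ε * u| :=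
          hto.abs (lt_mem_nhds h')
        refine tendsto_const_nhds.congr' ?_
        filter_upwards [hin] with ε h1
        simp only [hW]
        rw [indicator_of_notMem]
        intro h2
        exact absurd (abs_le.2 ⟨h2.1.le, h2.2⟩) (not_le.2 h1)
  have hfin : (∫ u : ℝ, (Real.sqrt Real.pi)⁻¹ * Real.exp (-1 * u ^ 2) * δ) = δ := by
    rw [integral_mul_const, integral_const_mul, integral_gaussian, div_one,
      inv_mul_cancel₀ (Real.sqrt_pos.2 Real.pi_pos).ne', one_mul]
  rw [hfin] at hlim
  refine hlim.congr' ?_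
  filter_upwards [hev] with ε hε
  exact (hrew ε hε).symm

lemma G_meas (z : ℝ) : Measurable (fun t => G t z) := by unfold G; fun_prop
lemma Gz_meas (z : ℝ) : Measurable (fun t => Gz t z) := by
  have := G_meas z
  unfold Gz; fun_prop

lemma G_int (z : ℝ) (hz : z ≠ 0) : IntervalIntegrable (fun t => G t z) volume 0 1 := by
  rw [intervalIntegrable_iff_integrableOn_Ioc_of_le (by norm_num)]
  refine Measure.integrableOn_of_bounded (M := 4 / z ^ 2) (by simp) (G_meas z).aestronglyMeasurable ?_
  exact (ae_restrict_iff' measurableSet_Ioc).2 (Eventually.of_forall fun t ht =>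
    G_bound t z ht.1 ht.2 hz)

lemma Gz_int (z : ℝ) (hz : z ≠ 0) : IntervalIntegrable (fun t => Gz t z) volume 0 1 := by
  rw [intervalIntegrable_iff_integrableOn_Ioc_of_le (by norm_num)]
  refine Measure.integrableOn_of_bounded (M := 16 / |z| ^ 3) (by simp) (Gz_meas z).aestronglyMeasurable ?_
  exact (ae_restrict_iff' measurableSet_Ioc).2 (Eventually.of_forall fun t ht =>
    Gz_bound t z ht.1 ht.2 hz)

lemma slice_cont {f : ℝ × ℝ → ℝ} (hf : ContinuousOn f (Icc (-1 : ℝ) 1 ×ˢ Icc (0 : ℝ) 1)) (y : ℝ)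
    (hy : y ∈ Icc (-1 : ℝ) 1) : ContinuousOn (fun t => f (y, t)) (uIcc 0 1) := by
  rw [uIcc_of_le (by norm_num)]
  exact hf.comp (by fun_prop) fun t ht => ⟨hy, ht⟩

lemma Sol.cv {v p v' p'} (S : Sol v p v' p') : ContinuousOn v (Icc (-1 : ℝ) 1 ×ˢ Icc (0 : ℝ) 1) :=
  fun q hq => (S.hv q hq).continuousAt.continuousWithinAt
lemma Sol.cp {v p v' p'} (S : Sol v p v' p') : ContinuousOn p (Icc (-1 : ℝ) 1 ×ˢ Icc (0 : ℝ) 1) :=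
  fun q hq => (S.hp q hq).continuousAt.continuousWithinAt

lemma lim_left (f : ℝ → ℝ) (hf : IntervalIntegrable f volume 0 1) :
    Tendsto (fun ε => ∫ t in ε..1, f t) (𝓝[>] 0) (𝓝 (∫ t in (0 : ℝ)..1, f t)) := by
  have := intervalIntegral.continuousOn_primitive_interval_left (a := 0) (b := 1) (f := f)
    (μ := volume) ((intervalIntegrable_iff' (by simp)).1 hf)
  have := this 0 (by simp)
  rw [uIcc_of_le (by norm_num)] at this
  refine this.tendsto.mono_left ?_
  refine nhdsWithin_le_iff.2 ?_
  exact mem_of_superset (Ioc_mem_nhdsGT one_pos) Ioc_subset_Icc_self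

lemma green_c {v p v' p'} (S : Sol v p v' p') (c : ℝ) (hc : |c| ≠ 1) :
    (∫ y in (-1 : ℝ)..1, G 1 (c - y) * v (y, 1)) - (if |c| < 1 then v (c, 0) else 0)
    = (∫ t in (0 : ℝ)..1, -Gz t (c - 1) * v (1, t)) - (∫ t in (0 : ℝ)..1, G t (c - 1) * p (1, t))
     - ((∫ t in (0 : ℝ)..1, -Gz t (c - (-1)) * v (-1, t))
        - ∫ t in (0 : ℝ)..1, G t (c - (-1)) * p (-1, t)) := by
  have hc1 : c - 1 ≠ 0 := by
    intro h; apply hc; rw [show c = 1 by linarith]; simp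
  have hc2 : c - (-1) ≠ 0 := by
    intro h; apply hc; rw [show c = -1 by linarith]; simp
  have i1 : IntervalIntegrable (fun t => -Gz t (c - 1) * v (1, t)) volume 0 1 :=
    (Gz_int _ hc1).neg.mul_continuousOn (slice_cont S.cv 1 (by norm_num))
  have i2 : IntervalIntegrable (fun t => G t (c - 1) * p (1, t)) volume 0 1 :=
    (G_int _ hc1).mul_continuousOn (slice_cont S.cp 1 (by norm_num))
  have i3 : IntervalIntegrable (fun t => -Gz t (c - (-1)) * v (-1, t)) volume 0 1 :=
    (Gz_int _ hc2).neg.mul_continuousOn (slice_cont S.cv (-1) (by norm_num))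
  have i4 : IntervalIntegrable (fun t => G t (c - (-1)) * p (-1, t)) volume 0 1 :=
    (G_int _ hc2).mul_continuousOn (slice_cont S.cp (-1) (by norm_num))
  rw [← intervalIntegral.integral_sub i1 i2, ← intervalIntegral.integral_sub i3 i4]
  have T1 := (delta_limit v S.cv c hc).const_sub (∫ y in (-1 : ℝ)..1, G 1 (c - y) * v (y, 1))
  have T2 := (lim_left _ (i1.sub i2)).sub (lim_left _ (i3.sub i4))
  refine tendsto_nhds_unique T1 (T2.congr' ?_)
  filter_upwards [Ioc_mem_nhdsGT one_pos] with ε hε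
  exact (green_eps S c ε hε.1 hε.2).symm

lemma tsum_int (F : ℤ → ℝ → ℝ) (M : ℤ → ℝ) (a b : ℝ) (hab : a ≤ b) (hm : ∀ k, Measurable (F k))
    (hb : ∀ k, ∀ t ∈ Ioc a b, |F k t| ≤ M k) (hM : Summable M) :
    IntervalIntegrable (fun t => ∑' k, F k t) volume a b := by
  rw [intervalIntegrable_iff_integrableOn_Ioc_of_le hab]
  have hms : AEStronglyMeasurable (fun t => ∑' k, F k t) (volume.restrict (Ioc a b)) := by
    refine aestronglyMeasurable_of_tendsto_ae (u := (atTop : Filter (Finset ℤ)))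
      (f := fun s t => ∑ k ∈ s, F k t) ?_ ?_
    · intro s
      exact (Finset.measurable_fun_sum s fun k _ => hm k).aestronglyMeasurable
    · refine (ae_restrict_iff' measurableSet_Ioc).2 (Eventually.of_forall fun t ht => ?_)
      exact (Summable.of_norm_bounded hM fun k => hb k t ht).hasSum
  refine ⟨hms, ?_⟩
  refine HasFiniteIntegral.of_bounded (C := ∑' k, M k) ?_
  refine (ae_restrict_iff' measurableSet_Ioc).2 (Eventually.of_forall fun t ht => ?_)
  exact tsum_of_norm_bounded hM.hasSum fun k => hb k t ht

lemma swap (F : ℤ → ℝ → ℝ) (M : ℤ → ℝ) (a b : ℝ) (hab : a ≤ b) (hm : ∀ k, Measurable (F k))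
    (hb : ∀ k, ∀ t ∈ Ioc a b, |F k t| ≤ M k) (hM : Summable M) (w : ℝ → ℝ)
    (hw : ContinuousOn w (uIcc a b)) :
    HasSum (fun k => ∫ t in a..b, F k t * w t) (∫ t in a..b, (∑' k, F k t) * w t) := by
  obtain ⟨C, hC⟩ := isCompact_uIcc.exists_bound_of_continuousOn hw
  have hsub : uIoc a b ⊆ uIcc a b := uIoc_subset_uIcc
  refine intervalIntegral.hasSum_integral_of_dominated_convergence (fun k _ => M k * C) ?_ ?_ ?_ ?_ ?_
  · intro k
    exact (hm k).aestronglyMeasurable.mul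
      ((hw.mono hsub).aestronglyMeasurable measurableSet_uIoc)
  · intro k
    refine Eventually.of_forall fun t ht => ?_
    rw [norm_mul]
    have h1 := hb k t (by rwa [uIoc_of_le hab] at ht)
    have h2 := hC t (hsub ht)
    exact mul_le_mul h1 h2 (norm_nonneg _) ((abs_nonneg _).trans h1)
  · exact Eventually.of_forall fun t _ => hM.mul_right C
  · exact intervalIntegrable_const
  · refine Eventually.of_forall fun t ht => ?_
    refine HasSum.mul_right _ ?_
    exact (Summable.of_norm_bounded hM fun k => hb k t (by rwa [uIoc_of_le hab] at ht)).hasSum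

lemma cne {x : ℝ} (hx : x ∈ Ioo (-1 : ℝ) 1) (m : ℤ) (hm : m % 4 = 1 ∨ m % 4 = 3) (k : ℤ) :
    (x + m) + 4 * (k : ℝ) ≠ 0 := by
  intro h
  have h1 : ((-1 : ℤ) : ℝ) < ((m + 4 * k : ℤ) : ℝ) := by push_cast; linarith [hx.2]
  have h2 : ((m + 4 * k : ℤ) : ℝ) < ((1 : ℤ) : ℝ) := by push_cast; linarith [hx.1]
  have h1' := Int.cast_lt.1 h1
  have h2' := Int.cast_lt.1 h2
  omega

lemma cne1 {x : ℝ} (hx : x ∈ Ioo (-1 : ℝ) 1) (k : ℤ) : (x - 1) + 4 * (k : ℝ) ≠ 0 := by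
  have := cne hx (-1) (by decide) k
  push_cast at this; rwa [← sub_eq_add_neg] at this
lemma cne2 {x : ℝ} (hx : x ∈ Ioo (-1 : ℝ) 1) (k : ℤ) : (x + 1) + 4 * (k : ℝ) ≠ 0 := by
  have := cne hx 1 (by decide) k
  push_cast at this; exact this
lemma cne3 {x : ℝ} (hx : x ∈ Ioo (-1 : ℝ) 1) (k : ℤ) : (x - 3) + 4 * (k : ℝ) ≠ 0 := by
  have := cne hx (-3) (by decide) k
  push_cast at this; rwa [← sub_eq_add_neg] at this

lemma abs_ne_one {c : ℝ} (h1 : c - 1 ≠ 0) (h2 : c + 1 ≠ 0) : |c| ≠ 1 := by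
  intro h
  rcases (abs_eq (zero_le_one)).1 h with h | h
  · apply h1; linarith
  · apply h2; linarith

lemma c_lt {x : ℝ} (hx : x ∈ Ioo (-1 : ℝ) 1) (k : ℤ) : |x + 4 * (k : ℝ)| < 1 ↔ k = 0 := by
  constructor
  · intro h
    rw [abs_lt] at h
    have h1 : ((-2 : ℤ) : ℝ) < ((4 * k : ℤ) : ℝ) := by push_cast; linarith [hx.2]
    have h2 : ((4 * k : ℤ) : ℝ) < ((2 : ℤ) : ℝ) := by push_cast; linarith [hx.1]
    have h1' := Int.cast_lt.1 h1
    have h2' := Int.cast_lt.1 h2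
    omega
  · rintro rfl
    simpa [abs_lt] using hx

lemma d_lt {x : ℝ} (hx : x ∈ Ioo (-1 : ℝ) 1) (k : ℤ) : ¬ |2 - x - 4 * (k : ℝ)| < 1 := by
  intro h
  rw [abs_lt] at h
  have h1 : ((0 : ℤ) : ℝ) < ((4 * k : ℤ) : ℝ) := by push_cast; linarith [hx.2]
  have h2 : ((4 * k : ℤ) : ℝ) < ((4 : ℤ) : ℝ) := by push_cast; linarith [hx.1]
  have h1' := Int.cast_lt.1 h1
  have h2' := Int.cast_lt.1 h2
  omega

lemma K_eq (t x y : ℝ) : K t x y = (Real.sqrt (4 * Real.pi * t))⁻¹ *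
    ((∑' k : ℤ, Real.exp (-((x - y) + 4 * (k : ℝ)) ^ 2 / (4 * t))) -
     (∑' k : ℤ, Real.exp (-((x + y - 2) + 4 * (k : ℝ)) ^ 2 / (4 * t)))) := by
  unfold K
  congr 4
  ext k
  rw [show x + y + 4 * (k : ℝ) - 2 = (x + y - 2) + 4 * (k : ℝ) by ring]

lemma K_tsum (t x y : ℝ) (ht : 0 < t) :
    K t x y = ∑' k : ℤ, (G t ((x + 4 * (k : ℝ)) - y) - G t ((2 - x - 4 * (k : ℝ)) - y)) := by
  rw [K_eq, ← (theta_summable t (x - y) ht).tsum_sub (theta_summable t (x + y - 2) ht),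
    ← tsum_mul_left]
  congr 1
  ext k
  rw [mul_sub, G, G]
  congr 5 <;> ring

lemma K_deriv (t x y : ℝ) (ht : 0 < t) (h1 : t ≤ 1) (ha : ∀ k : ℤ, (x - y) + 4 * (k : ℝ) ≠ 0)
    (hb : ∀ k : ℤ, (x + y - 2) + 4 * (k : ℝ) ≠ 0) :
    deriv (fun y => K t x y) y =
      ∑' k : ℤ, (-Gz t ((x + 4 * (k : ℝ)) - y) - -Gz t ((2 - x - 4 * (k : ℝ)) - y)) := by
  have e : (fun y => K t x y) = fun y => (Real.sqrt (4 * Real.pi * t))⁻¹ *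
    ((∑' k : ℤ, Real.exp (-((x - y) + 4 * (k : ℝ)) ^ 2 / (4 * t))) -
     (∑' k : ℤ, Real.exp (-((x + y - 2) + 4 * (k : ℝ)) ^ 2 / (4 * t)))) := by
    ext y; exact K_eq t x y
  have d1 := (theta_deriv t (x - y) ht ha).comp y ((hasDerivAt_id y).const_sub x)
  have d2 := (theta_deriv t (x + y - 2) ht hb).comp y (((hasDerivAt_id y).const_add x).sub_const 2)
  have d := ((d1.sub d2).const_mul (Real.sqrt (4 * Real.pi * t))⁻¹).deriv
  rw [e]
  refine Eq.trans d ?_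
  have s1 : Summable (fun k : ℤ => Gz t ((x - y) + 4 * (k : ℝ))) :=
    Summable.of_norm_bounded ((summable_inv_cube (x - y)).mul_left 16) fun k => by
      rw [mul_one_div]; exact Gz_bound t _ ht h1 (ha k)
  have s2 : Summable (fun k : ℤ => Gz t ((x + y - 2) + 4 * (k : ℝ))) :=
    Summable.of_norm_bounded ((summable_inv_cube (x + y - 2)).mul_left 16) fun k => by
      rw [mul_one_div]; exact Gz_bound t _ ht h1 (hb k)
  have e1 : ∀ a : ℝ, (Real.sqrt (4 * Real.pi * t))⁻¹ * (∑' k : ℤ, -((a + 4 * (k : ℝ)) / (2 * t)) *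
      Real.exp (-(a + 4 * (k : ℝ)) ^ 2 / (4 * t))) = ∑' k : ℤ, Gz t (a + 4 * (k : ℝ)) := by
    intro a
    rw [← tsum_mul_left]
    congr 1; ext k
    rw [Gz, G]; ring
  have e2 : (∑' k : ℤ, (-Gz t ((x + 4 * (k : ℝ)) - y) - -Gz t ((2 - x - 4 * (k : ℝ)) - y)))
      = ∑' k : ℤ, (-Gz t ((x - y) + 4 * (k : ℝ)) - Gz t ((x + y - 2) + 4 * (k : ℝ))) := by
    congr 1; ext k
    rw [show 2 - x - 4 * (k : ℝ) - y = -((x + y - 2) + 4 * (k : ℝ)) by ring, Gz_odd,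
      show (x + 4 * (k : ℝ)) - y = (x - y) + 4 * (k : ℝ) by ring]
    ring
  rw [e2, s1.neg.tsum_sub s2, tsum_neg, mul_sub, ← e1, ← e1]
  ring

lemma Gz_pair_bound (x y : ℝ) (ha : ∀ k : ℤ, (x - y) + 4 * (k : ℝ) ≠ 0)
    (hb : ∀ k : ℤ, (x + y - 2) + 4 * (k : ℝ) ≠ 0) (k : ℤ) (t : ℝ) (ht : t ∈ Ioc (0 : ℝ) 1) :
    |-Gz t ((x + 4 * (k : ℝ)) - y) - -Gz t ((2 - x - 4 * (k : ℝ)) - y)| ≤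
      16 * (1 / |(x - y) + 4 * (k : ℝ)| ^ 3) + 16 * (1 / |(x + y - 2) + 4 * (k : ℝ)| ^ 3) := by
  rw [show 2 - x - 4 * (k : ℝ) - y = -((x + y - 2) + 4 * (k : ℝ)) by ring, Gz_odd,
      show (x + 4 * (k : ℝ)) - y = (x - y) + 4 * (k : ℝ) by ring, mul_one_div, mul_one_div]
  have b1 := Gz_bound t _ ht.1 ht.2 (ha k)
  have b2 := Gz_bound t _ ht.1 ht.2 (hb k)
  refine (abs_sub _ _).trans ?_
  rw [abs_neg, neg_neg]
  linarith

lemma Gz_pair_summable (x y : ℝ) : Summable fun k : ℤ =>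
      16 * (1 / |(x - y) + 4 * (k : ℝ)| ^ 3) + 16 * (1 / |(x + y - 2) + 4 * (k : ℝ)| ^ 3) :=
  ((summable_inv_cube _).mul_left 16).add ((summable_inv_cube _).mul_left 16)

lemma G_pair_bound {x : ℝ} (hx : x ∈ Ioo (-1 : ℝ) 1) (k : ℤ) (y : ℝ) (hy : y ∈ Ioc (-1 : ℝ) 1) :
    |G 1 ((x + 4 * (k : ℝ)) - y) - G 1 ((2 - x - 4 * (k : ℝ)) - y)| ≤
      16 * (1 / ((x + 1) + 4 * (k : ℝ)) ^ 2) + 16 * (1 / ((x - 3) + 4 * (k : ℝ)) ^ 2) := by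
  have b1 := G_one_bound (x + 4 * (k : ℝ)) y (Ioc_subset_Icc_self hy)
    (by have := cne2 hx k; intro h; apply this; linarith)
  have b2 := G_one_bound (2 - x - 4 * (k : ℝ)) y (Ioc_subset_Icc_self hy)
    (by have := cne3 hx k; intro h; apply this; linarith)
  rw [show (2 - x - 4 * (k : ℝ) + 1) ^ 2 = ((x - 3) + 4 * (k : ℝ)) ^ 2 by ring] at b2
  rw [show (x + 4 * (k : ℝ) + 1) ^ 2 = ((x + 1) + 4 * (k : ℝ)) ^ 2 by ring] at b1
  refine (abs_sub _ _).trans ?_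
  rw [mul_one_div, mul_one_div]
  linarith

lemma G_pair_summable (x : ℝ) : Summable fun k : ℤ =>
      16 * (1 / ((x + 1) + 4 * (k : ℝ)) ^ 2) + 16 * (1 / ((x - 3) + 4 * (k : ℝ)) ^ 2) :=
  ((summable_inv_sq _).mul_left 16).add ((summable_inv_sq _).mul_left 16)

lemma G_meas2 (c : ℝ) : Continuous (fun y => G 1 (c - y)) := by unfold G; fun_prop

lemma green_sol {v p v' p'} (S : Sol v p v' p') {x : ℝ} (hx : x ∈ Ioo (-1 : ℝ) 1) :
    v (x, 0) = (∫ y in (-1 : ℝ)..1, K 1 x y * v (y, 1))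
      - (∫ t in (0 : ℝ)..1, v (1, t) * deriv (fun y => K t x y) 1)
      + (∫ t in (0 : ℝ)..1, v (-1, t) * deriv (fun y => K t x y) (-1)) := by
  have ap : ∀ k : ℤ, (x - 1) + 4 * (k : ℝ) ≠ 0 := cne1 hx
  have bp : ∀ k : ℤ, (x + 1 - 2) + 4 * (k : ℝ) ≠ 0 := fun k => by
    have := cne1 hx k; intro h; apply this; linarith
  have am : ∀ k : ℤ, (x - (-1)) + 4 * (k : ℝ) ≠ 0 := fun k => by
    have := cne2 hx k; intro h; apply this; linarith
  have bm : ∀ k : ℤ, (x + (-1) - 2) + 4 * (k : ℝ) ≠ 0 := fun k => by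
    have := cne3 hx k; intro h; apply this; linarith
  have hvy : ContinuousOn (fun y => v (y, 1)) (uIcc (-1) 1) := by
    rw [uIcc_of_le (by norm_num)]
    exact S.cv.comp (by fun_prop) fun t ht => ⟨ht, by norm_num⟩
  have H1 := swap (fun k y => G 1 ((x + 4 * (k : ℝ)) - y) - G 1 ((2 - x - 4 * (k : ℝ)) - y)) _
    (-1) 1 (by norm_num) (fun k => ((G_meas2 _).sub (G_meas2 _)).measurable) (G_pair_bound hx) (G_pair_summable x)
    (fun y => v (y, 1)) hvy
  have H2 := swap (fun k t => -Gz t ((x + 4 * (k : ℝ)) - 1) - -Gz t ((2 - x - 4 * (k : ℝ)) - 1)) _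
    0 1 (by norm_num) (fun k => (Gz_meas _).neg.sub (Gz_meas _).neg) (Gz_pair_bound x 1 ap bp)
    (Gz_pair_summable x 1) (fun t => v (1, t)) (slice_cont S.cv 1 (by norm_num))
  have H3 := swap (fun k t => -Gz t ((x + 4 * (k : ℝ)) - (-1)) - -Gz t ((2 - x - 4 * (k : ℝ)) - (-1))) _
    0 1 (by norm_num) (fun k => (Gz_meas _).neg.sub (Gz_meas _).neg) (Gz_pair_bound x (-1) am bm)
    (Gz_pair_summable x (-1)) (fun t => v (-1, t)) (slice_cont S.cv (-1) (by norm_num))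
  have H4 := swap (fun k t => G t ((x - (-1)) + 4 * (k : ℝ))) (fun k => 4 * (1 / ((x - (-1)) + 4 * (k : ℝ)) ^ 2))
    0 1 (by norm_num) (fun k => G_meas _)
    (fun k t ht => by rw [mul_one_div]; exact G_bound t _ ht.1 ht.2 (am k))
    ((summable_inv_sq _).mul_left 4) (fun t => p (-1, t)) (slice_cont S.cp (-1) (by norm_num))
  set N : ℤ → ℝ := fun k => ∫ t in (0 : ℝ)..1, G t ((x - (-1)) + 4 * (k : ℝ)) * p (-1, t) with hN
  have H5 : HasSum (fun k => N (k - 1)) (∫ t in (0 : ℝ)..1, (∑' k : ℤ, G t ((x - (-1)) + 4 * (k : ℝ))) * p (-1, t)) :=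
    (Equiv.subRight (1 : ℤ)).hasSum_iff.2 H4
  have H6 : HasSum (fun k : ℤ => if k = 0 then v (x, 0) else 0) (v (x, 0)) := hasSum_ite_eq 0 _
  have I1 : (∫ y in (-1 : ℝ)..1, K 1 x y * v (y, 1)) = ∫ y in (-1 : ℝ)..1,
      (∑' k : ℤ, (G 1 ((x + 4 * (k : ℝ)) - y) - G 1 ((2 - x - 4 * (k : ℝ)) - y))) * v (y, 1) := by
    congr 1; ext y; rw [K_tsum 1 x y one_pos]
  have I2 : (∫ t in (0 : ℝ)..1, v (1, t) * deriv (fun y => K t x y) 1) = ∫ t in (0 : ℝ)..1,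
      (∑' k : ℤ, (-Gz t ((x + 4 * (k : ℝ)) - 1) - -Gz t ((2 - x - 4 * (k : ℝ)) - 1))) * v (1, t) := by
    refine intervalIntegral.integral_congr_ae (Eventually.of_forall fun t ht => ?_)
    rw [uIoc_of_le (by norm_num)] at ht
    rw [K_deriv t x 1 ht.1 ht.2 ap bp, mul_comm]
  have I3 : (∫ t in (0 : ℝ)..1, v (-1, t) * deriv (fun y => K t x y) (-1)) = ∫ t in (0 : ℝ)..1,
      (∑' k : ℤ, (-Gz t ((x + 4 * (k : ℝ)) - (-1)) - -Gz t ((2 - x - 4 * (k : ℝ)) - (-1)))) * v (-1, t) := by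
    refine intervalIntegral.integral_congr_ae (Eventually.of_forall fun t ht => ?_)
    rw [uIoc_of_le (by norm_num)] at ht
    rw [K_deriv t x (-1) ht.1 ht.2 am bm, mul_comm]
  rw [I1, I2, I3]
  have HL := H1.sub H6
  have HR := (H2.sub H3).add (H4.sub H5)
  have := HL.unique (HR.congr_fun ?_)
  · linarith
  intro k
  have c1 : x + 4 * (k : ℝ) - 1 ≠ 0 := by have := ap k; intro h; apply this; linarith
  have c2 : x + 4 * (k : ℝ) - (-1) ≠ 0 := by have := am k; intro h; apply this; linarith
  have d1 : 2 - x - 4 * (k : ℝ) - 1 ≠ 0 := by have := bp k; intro h; apply this; linarith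
  have d2 : 2 - x - 4 * (k : ℝ) - (-1) ≠ 0 := by have := bm k; intro h; apply this; linarith
  have gc := green_c S (x + 4 * (k : ℝ)) (abs_ne_one c1 (by rwa [sub_neg_eq_add] at c2))
  have gd := green_c S (2 - x - 4 * (k : ℝ)) (abs_ne_one d1 (by rwa [sub_neg_eq_add] at d2))
  rw [if_neg (d_lt hx k)] at gd
  have hδ : (if |x + 4 * (k : ℝ)| < 1 then v (x + 4 * (k : ℝ), 0) else 0) =
      if k = 0 then v (x, 0) else 0 := by
    simp only [c_lt hx k]
    split_ifs with h
    · simp [h]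
    · rfl
  rw [hδ] at gc
  have n1 : (∫ t in (0 : ℝ)..1, G t (2 - x - 4 * (k : ℝ) - 1) * p (1, t)) =
      ∫ t in (0 : ℝ)..1, G t (x + 4 * (k : ℝ) - 1) * p (1, t) := by
    congr 1; ext t
    rw [show 2 - x - 4 * (k : ℝ) - 1 = -(x + 4 * (k : ℝ) - 1) by ring, G_even]
  have n2 : (∫ t in (0 : ℝ)..1, G t (2 - x - 4 * (k : ℝ) - (-1)) * p (-1, t)) = N (k - 1) := by
    rw [hN]; congr 1; ext t
    push_cast
    rw [show 2 - x - 4 * (k : ℝ) - (-1) = -((x - (-1)) + 4 * ((k : ℝ) - 1)) by ring, G_even]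
  have n3 : (∫ t in (0 : ℝ)..1, G t (x + 4 * (k : ℝ) - (-1)) * p (-1, t)) = N k := by
    rw [hN]; congr 1; ext t
    rw [show x + 4 * (k : ℝ) - (-1) = (x - (-1)) + 4 * (k : ℝ) by ring]
  rw [n1, n2] at gd
  rw [n3] at gc
  have w1 : ContinuousOn (fun t => v (1, t)) (uIcc 0 1) := slice_cont S.cv 1 (by norm_num)
  have w2 : ContinuousOn (fun t => v (-1, t)) (uIcc 0 1) := slice_cont S.cv (-1) (by norm_num)
  simp only [sub_mul]
  rw [intervalIntegral.integral_sub, intervalIntegral.integral_sub, intervalIntegral.integral_sub]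
  · linarith
  · exact (Gz_int _ c2).neg.mul_continuousOn w2
  · exact (Gz_int _ d2).neg.mul_continuousOn w2
  · exact (Gz_int _ c1).neg.mul_continuousOn w1
  · exact (Gz_int _ d1).neg.mul_continuousOn w1
  · exact ((G_meas2 _).intervalIntegrable _ _).mul_continuousOn hvy
  · exact ((G_meas2 _).intervalIntegrable _ _).mul_continuousOn hvy

lemma heat_fderiv {h : ℝ → ℝ → ℝ} (hh : IsHeatSolution h) (z : ℝ × ℝ)
    (hz : z ∈ Ioo (-1 : ℝ) 1 ×ˢ Ioo (-1 : ℝ) 0) :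
    HasFDerivAt (fun p : ℝ × ℝ => h p.1 p.2) (fderiv ℝ (fun p : ℝ × ℝ => h p.1 p.2) z) z ∧
    HasFDerivAt (fun w => fderiv ℝ (fun p : ℝ × ℝ => h p.1 p.2) w (1, 0))
      (fderiv ℝ (fun w => fderiv ℝ (fun p : ℝ × ℝ => h p.1 p.2) w (1, 0)) z) z ∧
    fderiv ℝ (fun w => fderiv ℝ (fun p : ℝ × ℝ => h p.1 p.2) w (1, 0)) z (1, 0) =
      fderiv ℝ (fun p : ℝ × ℝ => h p.1 p.2) z (0, 1) := by
  obtain ⟨_, hs, he⟩ := hh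
  set H := fun p : ℝ × ℝ => h p.1 p.2 with hH
  have hO : IsOpen (Ioo (-1 : ℝ) 1 ×ˢ Ioo (-1 : ℝ) 0) := isOpen_Ioo.prod isOpen_Ioo
  have hs' : ContDiffOn ℝ (⊤ : ℕ∞) H (Ioo (-1 : ℝ) 1 ×ˢ Ioo (-1 : ℝ) 0) :=
    hs.mono (prod_mono le_rfl Ioo_subset_Ioc_self)
  have hat : ∀ w ∈ Ioo (-1 : ℝ) 1 ×ˢ Ioo (-1 : ℝ) 0, ContDiffAt ℝ (⊤ : ℕ∞) H w := fun w hw =>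
    hs'.contDiffAt (hO.mem_nhds hw)
  have hd : ∀ w ∈ Ioo (-1 : ℝ) 1 ×ˢ Ioo (-1 : ℝ) 0, HasFDerivAt H (fderiv ℝ H w) w := fun w hw =>
    ((hat w hw).differentiableAt (by simp)).hasFDerivAt
  have hd1 : HasFDerivAt (fun w => fderiv ℝ H w (1, 0))
      (fderiv ℝ (fun w => fderiv ℝ H w (1, 0)) z) z := by
    have h1 : ContDiffAt ℝ 1 (fderiv ℝ H) z :=
      (hat z hz).fderiv_right (m := 1) (WithTop.coe_le_coe.2 (le_top : (1 + 1 : ℕ∞) ≤ ⊤))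
    have h2 : DifferentiableAt ℝ (fderiv ℝ H) z := h1.differentiableAt (by simp)
    exact (h2.clm_apply (differentiableAt_const _)).hasFDerivAt
  refine ⟨hd z hz, hd1, ?_⟩
  have lx : ∀ y t : ℝ, HasDerivAt (fun y : ℝ => (y, t)) ((1 : ℝ), (0 : ℝ)) y := fun y t =>
    (hasDerivAt_id y).prodMk (hasDerivAt_const y t)
  have lt : ∀ y t : ℝ, HasDerivAt (fun t : ℝ => (y, t)) ((0 : ℝ), (1 : ℝ)) t := fun y t =>
    (hasDerivAt_const t y).prodMk (hasDerivAt_id t)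
  have eqn := he z.1 hz.1 z.2 (Ioo_subset_Ioc_self hz.2)
  rw [derivWithin_of_mem_nhds (Iic_mem_nhds hz.2.2)] at eqn
  have e1 : deriv (fun s => h z.1 s) z.2 = fderiv ℝ H z (0, 1) :=
    (HasFDerivAt.comp_hasDerivAt z.2 (f := fun t : ℝ => (z.1, t)) (hd z hz) (lt z.1 z.2)).deriv
  have e2 : deriv (fun y => h y z.2) =ᶠ[𝓝 z.1] fun y => fderiv ℝ H (y, z.2) (1, 0) := by
    filter_upwards [isOpen_Ioo.mem_nhds hz.1] with y hy
    exact (HasFDerivAt.comp_hasDerivAt y (f := fun y : ℝ => (y, z.2)) (hd (y, z.2) ⟨hy, hz.2⟩)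
      (lx y z.2)).deriv
  have e3 : deriv (fun y => fderiv ℝ H (y, z.2) (1, 0)) z.1 =
      fderiv ℝ (fun w => fderiv ℝ H w (1, 0)) z (1, 0) :=
    (HasFDerivAt.comp_hasDerivAt z.1 (f := fun y : ℝ => (y, z.2)) hd1 (lx z.1 z.2)).deriv
  rw [e1, e2.deriv_eq, e3] at eqn
  exact eqn.symm

/-- parabolic rescaling. -/
noncomputable def phi (r : ℝ) (q : ℝ × ℝ) : ℝ × ℝ := (r * q.1, -(r ^ 2 * q.2) - (1 - r ^ 2) / 2)

lemma phi_mem {r : ℝ} (hr : r ∈ Ioo (0 : ℝ) 1) {q : ℝ × ℝ} (hq : q ∈ Icc (-1 : ℝ) 1 ×ˢ Icc (0 : ℝ) 1) :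
    phi r q ∈ Ioo (-1 : ℝ) 1 ×ˢ Ioo (-1 : ℝ) 0 := by
  obtain ⟨⟨h1, h2⟩, h3, h4⟩ := hq
  obtain ⟨r0, r1⟩ := hr
  have hr2 : r ^ 2 < 1 := by nlinarith
  have hr20 : 0 < r ^ 2 := by positivity
  refine ⟨⟨?_, ?_⟩, ?_, ?_⟩ <;> simp only [phi] <;> nlinarith

lemma phi_sol {h : ℝ → ℝ → ℝ} (hh : IsHeatSolution h) {r : ℝ} (hr : r ∈ Ioo (0 : ℝ) 1) :
    ∃ p v' p', Sol (fun q => h (phi r q).1 (phi r q).2) p v' p' := by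
  set A : ℝ × ℝ →L[ℝ] ℝ × ℝ := (r • ContinuousLinearMap.fst ℝ ℝ ℝ).prod
    ((-r ^ 2) • ContinuousLinearMap.snd ℝ ℝ ℝ) with hA
  have hphi : ∀ q, HasFDerivAt (phi r) A q := by
    intro q
    have h1 : HasFDerivAt (fun q : ℝ × ℝ => q.1) (ContinuousLinearMap.fst ℝ ℝ ℝ) q := hasFDerivAt_fst
    have h2 : HasFDerivAt (fun q : ℝ × ℝ => q.2) (ContinuousLinearMap.snd ℝ ℝ ℝ) q := hasFDerivAt_snd
    refine ((h1.const_mul r).prodMk ((h2.const_mul (r ^ 2)).neg.sub_const ((1 - r ^ 2) / 2))).congr_fderiv ?_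
    ext <;> simp [hA]
  have A1 : A (1, 0) = r • (1, 0) := by simp [hA]
  have A2 : A (0, 1) = (-r ^ 2) • (0, 1) := by simp [hA]
  set H := fun p : ℝ × ℝ => h p.1 p.2 with hH
  refine ⟨fun q => r * fderiv ℝ H (phi r q) (1, 0), fun q => (fderiv ℝ H (phi r q)).comp A,
    fun q => r • (fderiv ℝ (fun w => fderiv ℝ H w (1, 0)) (phi r q)).comp A, ?_, ?_, ?_, ?_⟩
  · intro q hq
    exact (heat_fderiv hh _ (phi_mem hr hq)).1.comp q (hphi q)
  · intro q hq
    exact ((heat_fderiv hh _ (phi_mem hr hq)).2.1.comp q (hphi q)).const_mul r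
  · intro q hq
    rw [ContinuousLinearMap.comp_apply, A1, map_smul, smul_eq_mul]
  · intro q hq
    have := (heat_fderiv hh _ (phi_mem hr hq)).2.2
    rw [smul_apply, ContinuousLinearMap.comp_apply, ContinuousLinearMap.comp_apply,
      A1, A2, map_smul, map_smul, this]
    simp only [smul_eq_mul]
    ring

lemma phi_lim {h : ℝ → ℝ → ℝ} (hh : IsHeatSolution h) {q : ℝ × ℝ}
    (hq : q ∈ Icc (-1 : ℝ) 1 ×ˢ Icc (0 : ℝ) 1) :
    Tendsto (fun r => h (phi r q).1 (phi r q).2) (𝓝[<] 1) (𝓝 (h q.1 (-q.2))) := by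
  have hev : ∀ᶠ r in 𝓝[<] (1 : ℝ), r ∈ Ioo (0 : ℝ) 1 := Ioo_mem_nhdsLT one_pos
  have hc := hh.1 (q.1, -q.2) ⟨hq.1, by constructor <;> simp <;> linarith [hq.2.1, hq.2.2]⟩
  have ht : Tendsto (fun r => phi r q) (𝓝[<] 1) (𝓝[Icc (-1 : ℝ) 1 ×ˢ Icc (-1 : ℝ) 0] (q.1, -q.2)) := by
    refine tendsto_nhdsWithin_iff.2 ⟨?_, ?_⟩
    · have : Continuous (fun r => phi r q) := by unfold phi; fun_prop
      have := (this.tendsto 1).mono_left (nhdsWithin_le_nhds (s := Iio 1))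
      simpa [phi] using this
    · filter_upwards [hev] with r hr
      have := phi_mem hr hq
      exact ⟨Ioo_subset_Icc_self this.1, Ioo_subset_Icc_self this.2⟩
  exact hc.tendsto.comp ht

lemma int_lim (k : ℝ → ℝ) (a b C : ℝ) (hab : a ≤ b) (hk : IntervalIntegrable k volume a b)
    (w : ℝ → ℝ → ℝ) (w0 : ℝ → ℝ)
    (hw : ∀ r ∈ Ioo (0 : ℝ) 1, ContinuousOn (w r) (Icc a b))
    (hC : ∀ r ∈ Ioo (0 : ℝ) 1, ∀ t ∈ Icc a b, |w r t| ≤ C)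
    (hl : ∀ t ∈ Icc a b, Tendsto (fun r => w r t) (𝓝[<] 1) (𝓝 (w0 t))) :
    Tendsto (fun r => ∫ t in a..b, k t * w r t) (𝓝[<] 1) (𝓝 (∫ t in a..b, k t * w0 t)) := by
  have hev : ∀ᶠ r in 𝓝[<] (1 : ℝ), r ∈ Ioo (0 : ℝ) 1 := Ioo_mem_nhdsLT one_pos
  have hsub : uIoc a b ⊆ Icc a b := by rw [uIoc_of_le hab]; exact Ioc_subset_Icc_self
  refine intervalIntegral.tendsto_integral_filter_of_dominated_convergence (fun t => |k t| * C) ?_ ?_ ?_ ?_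
  · filter_upwards [hev] with r hr
    exact (intervalIntegrable_iff.1 hk).aestronglyMeasurable.mul
      (((hw r hr).mono hsub).aestronglyMeasurable measurableSet_uIoc)
  · filter_upwards [hev] with r hr
    refine Eventually.of_forall fun t ht => ?_
    rw [norm_mul, Real.norm_eq_abs, Real.norm_eq_abs]
    exact mul_le_mul_of_nonneg_left (hC r hr t (hsub ht)) (abs_nonneg _)
  · exact hk.abs.mul_const C
  · exact Eventually.of_forall fun t ht => (hl t (hsub ht)).const_mul _

lemma K1_int {x : ℝ} (hx : x ∈ Ioo (-1 : ℝ) 1) : IntervalIntegrable (fun y => K 1 x y) volume (-1) 1 := by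
  have := tsum_int (fun k y => G 1 ((x + 4 * (k : ℝ)) - y) - G 1 ((2 - x - 4 * (k : ℝ)) - y)) _
    (-1) 1 (by norm_num) (fun k => ((G_meas2 _).sub (G_meas2 _)).measurable) (G_pair_bound hx) (G_pair_summable x)
  have e : (fun y => K 1 x y) = fun y =>
      ∑' k : ℤ, (G 1 ((x + 4 * (k : ℝ)) - y) - G 1 ((2 - x - 4 * (k : ℝ)) - y)) := by
    ext y; exact K_tsum 1 x y one_pos
  rwa [e]

lemma Kd_int (x y : ℝ) (ha : ∀ k : ℤ, (x - y) + 4 * (k : ℝ) ≠ 0)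
    (hb : ∀ k : ℤ, (x + y - 2) + 4 * (k : ℝ) ≠ 0) :
    IntervalIntegrable (fun t => deriv (fun y => K t x y) y) volume 0 1 := by
  have := tsum_int (fun k t => -Gz t ((x + 4 * (k : ℝ)) - y) - -Gz t ((2 - x - 4 * (k : ℝ)) - y)) _
    0 1 (by norm_num) (fun k => (Gz_meas _).neg.sub (Gz_meas _).neg) (Gz_pair_bound x y ha hb)
    (Gz_pair_summable x y)
  rw [intervalIntegrable_iff_integrableOn_Ioc_of_le (by norm_num)] at this ⊢
  exact this.congr_fun (fun t ht => (K_deriv t x y ht.1 ht.2 ha hb).symm) measurableSet_Ioc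

/-- Green's representation formula: for a solution `h` of the heat equation on
`[-1,1] × [-1,0]` and `x ∈ (-1,1)`,
`h(x,0) = ∫_{-1}^{1} K_1(x,y) h(y,-1) dy − ∫_0^1 h(1,-t) ∂_y K_t(x,y)|_{y=1} dt
          + ∫_0^1 h(-1,-t) ∂_y K_t(x,y)|_{y=-1} dt`. -/
theorem greens_representation_formula (h : ℝ → ℝ → ℝ) (hheat : IsHeatSolution h) :
    ∀ x ∈ Set.Ioo (-1 : ℝ) 1,
      h x 0 = (∫ y in (-1 : ℝ)..1, K 1 x y * h y (-1))
        - (∫ t in (0 : ℝ)..1, h 1 (-t) * deriv (fun y => K t x y) 1)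
        + (∫ t in (0 : ℝ)..1, h (-1) (-t) * deriv (fun y => K t x y) (-1)) := by
  intro x hx
  have ap : ∀ k : ℤ, (x - 1) + 4 * (k : ℝ) ≠ 0 := cne1 hx
  have bp : ∀ k : ℤ, (x + 1 - 2) + 4 * (k : ℝ) ≠ 0 := fun k => by
    have := cne1 hx k; intro h; apply this; linarith
  have am : ∀ k : ℤ, (x - (-1)) + 4 * (k : ℝ) ≠ 0 := fun k => by
    have := cne2 hx k; intro h; apply this; linarith
  have bm : ∀ k : ℤ, (x + (-1) - 2) + 4 * (k : ℝ) ≠ 0 := fun k => by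
    have := cne3 hx k; intro h; apply this; linarith
  obtain ⟨C, hC⟩ := (isCompact_Icc.prod isCompact_Icc).exists_bound_of_continuousOn hheat.1
  have hCr : ∀ r ∈ Ioo (0 : ℝ) 1, ∀ q ∈ Icc (-1 : ℝ) 1 ×ˢ Icc (0 : ℝ) 1,
      |h (phi r q).1 (phi r q).2| ≤ C := by
    intro r hr q hq
    have := phi_mem hr hq
    exact hC (phi r q) ⟨Ioo_subset_Icc_self this.1, Ioo_subset_Icc_self this.2⟩
  have hcont : ∀ r ∈ Ioo (0 : ℝ) 1, ContinuousOn (fun q => h (phi r q).1 (phi r q).2)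
      (Icc (-1 : ℝ) 1 ×ˢ Icc (0 : ℝ) 1) := by
    intro r hr
    obtain ⟨p, v', p', S⟩ := phi_sol hheat hr
    exact S.cv
  have m1 : (1 : ℝ) ∈ Icc (-1 : ℝ) 1 := by norm_num
  have m2 : (-1 : ℝ) ∈ Icc (-1 : ℝ) 1 := by norm_num
  have m3 : (1 : ℝ) ∈ Icc (0 : ℝ) 1 := by norm_num
  have T0 := phi_lim hheat (q := (x, 0)) ⟨Ioo_subset_Icc_self hx, by norm_num⟩
  have T1 := int_lim (fun y => K 1 x y) (-1) 1 C (by norm_num) (K1_int hx)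
    (fun r y => h (phi r (y, 1)).1 (phi r (y, 1)).2) (fun y => h y (-1))
    (fun r hr => (hcont r hr).comp (by fun_prop) fun y hy => ⟨hy, m3⟩)
    (fun r hr y hy => hCr r hr (y, 1) ⟨hy, m3⟩) (fun y hy => phi_lim hheat (q := (y, 1)) ⟨hy, m3⟩)
  have T2 := int_lim (fun t => deriv (fun y => K t x y) 1) 0 1 C (by norm_num) (Kd_int x 1 ap bp)
    (fun r t => h (phi r (1, t)).1 (phi r (1, t)).2) (fun t => h 1 (-t))
    (fun r hr => (hcont r hr).comp (by fun_prop) fun y hy => ⟨m1, hy⟩)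
    (fun r hr y hy => hCr r hr (1, y) ⟨m1, hy⟩) (fun y hy => phi_lim hheat (q := (1, y)) ⟨m1, hy⟩)
  have T3 := int_lim (fun t => deriv (fun y => K t x y) (-1)) 0 1 C (by norm_num) (Kd_int x (-1) am bm)
    (fun r t => h (phi r (-1, t)).1 (phi r (-1, t)).2) (fun t => h (-1) (-t))
    (fun r hr => (hcont r hr).comp (by fun_prop) fun y hy => ⟨m2, hy⟩)
    (fun r hr y hy => hCr r hr (-1, y) ⟨m2, hy⟩) (fun y hy => phi_lim hheat (q := (-1, y)) ⟨m2, hy⟩)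
  have T := (T1.sub T2).add T3
  have hmain : h x 0 = (∫ y in (-1 : ℝ)..1, K 1 x y * h y (-1))
      - (∫ t in (0 : ℝ)..1, deriv (fun y => K t x y) 1 * h 1 (-t))
      + (∫ t in (0 : ℝ)..1, deriv (fun y => K t x y) (-1) * h (-1) (-t)) := by
    simp only [neg_zero] at T0
    refine tendsto_nhds_unique T0 (T.congr' ?_)
    filter_upwards [Ioo_mem_nhdsLT one_pos] with r hr
    obtain ⟨p, v', p', S⟩ := phi_sol hheat hr
    have := green_sol S hx
    simp only [mul_comm] at this ⊢
    exact this.symm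
  rw [hmain]
  simp only [mul_comm]
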